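/- arXiv:1111.6403 — 2 statements merged into one kernel-verified Lean document; each statement's English description precedes it below -/
import Mathlib

section
/- Let l, m be natural numbers, let d_p : Fin l → ℝ and d_q : Fin m → ℝ have all entries positive, and set M_p = diagonal(d_p), M_q = diagonal(d_q), M_p^{1/2} = diagonal(√d_p), M_q^{1/2} = diagonal(√d_q). Let t_f > 0, let δe_p : ℝ → ℝ^l and δe_q : ℝ → ℝ^m be continuously differentiable with δe_p(0) = 0 and δe_q(0) = 0, and let ρ_p : ℝ → ℝ^l, ρ_q : ℝ → ℝ^m be continuous functions such that for all t ∈ [0, t_f]: δe_p(t) · M_p δe_p′(t) + δe_q(t) · M_q δe_q′(t) = −δe_p(t) · ρ_p(t) − δe_q(t) · ρ_q(t). Then ½ ‖M_p^{1/2} δe_p(t_f)‖² + ½ ‖M_q^{1/2} δe_q(t_f)‖² ≤ ∫₀^{t_f} ( ‖ρ_p(τ)‖ ‖δe_p(τ)‖ + ‖ρ_q(τ)‖ ‖δe_q(τ)‖ ) dτ, where ‖·‖ is the Euclidean norm. -/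
open Matrix

/-- The Euclidean norm of a vector in `ℝ^n`. -/
noncomputable def euclidEnorm {n : ℕ} (x : Fin n → ℝ) : ℝ := Real.sqrt (x ⬝ᵥ x)

theorem euclid_abs_dot_le {n : ℕ} (x y : Fin n → ℝ) :
    -(x ⬝ᵥ y) ≤ euclidEnorm y * euclidEnorm x := by
  have h := Finset.sum_mul_sq_le_sq_mul_sq Finset.univ x y
  have h1 : |x ⬝ᵥ y| ≤ Real.sqrt ((y ⬝ᵥ y) * (x ⬝ᵥ x)) := by
    apply Real.abs_le_sqrt
    simp only [dotProduct, ← pow_two]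
    linarith
  have hy : 0 ≤ y ⬝ᵥ y := Finset.sum_nonneg fun i _ => mul_self_nonneg _
  unfold euclidEnorm
  rw [← Real.sqrt_mul hy]
  exact (neg_le_abs _).trans h1

theorem euclid_continuous {n : ℕ} {f : ℝ → Fin n → ℝ} (hf : Continuous f) :
    Continuous fun t => euclidEnorm (f t) := by
  unfold euclidEnorm
  exact Real.continuous_sqrt.comp (hf.dotProduct hf)

theorem euclid_energy_eq {n : ℕ} (d : Fin n → ℝ) (hd : ∀ i, 0 < d i) (x : Fin n → ℝ) :
    euclidEnorm ((Matrix.diagonal fun i => Real.sqrt (d i)).mulVec x) ^ 2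
      = ∑ i, d i * x i ^ 2 := by
  unfold euclidEnorm
  rw [Real.sq_sqrt (by exact Finset.sum_nonneg fun i _ => mul_self_nonneg _)]
  simp only [dotProduct, Matrix.mulVec_diagonal]
  refine Finset.sum_congr rfl fun i _ => ?_
  have := Real.mul_self_sqrt (hd i).le
  calc _ = (√(d i) * √(d i)) * x i ^ 2 := by ring
    _ = _ := by rw [this]

theorem euclid_energy_deriv {n : ℕ} (d : Fin n → ℝ) (f : ℝ → Fin n → ℝ)
    (hf : ContDiff ℝ 1 f) (t : ℝ) :
    HasDerivAt (fun s => (1 / 2) * ∑ i, d i * f s i ^ 2)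
      (f t ⬝ᵥ (Matrix.diagonal d).mulVec (deriv f t)) t := by
  have h := (hf.differentiable one_ne_zero t).hasDerivAt
  rw [hasDerivAt_pi] at h
  have h2 := (HasDerivAt.fun_sum (u := Finset.univ)
    fun i _ => ((h i).fun_pow 2).const_mul (d i)).const_mul (1 / 2 : ℝ)
  refine h2.congr_deriv ?_
  simp only [dotProduct, Matrix.mulVec_diagonal, Finset.mul_sum]
  refine Finset.sum_congr rfl fun i _ => ?_
  norm_num
  ring

/-- The integrated error-energy inequality: the weighted error energy at time `t_f`
is bounded by the time integral of the residue-error products. -/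
theorem error_energy_integral_bound (l m : ℕ) (d_p : Fin l → ℝ) (d_q : Fin m → ℝ)
    (hdp : ∀ i, 0 < d_p i) (hdq : ∀ j, 0 < d_q j)
    (t_f : ℝ) (ht : 0 < t_f)
    (δe_p : ℝ → Fin l → ℝ) (δe_q : ℝ → Fin m → ℝ)
    (hc1 : ContDiff ℝ 1 δe_p) (hc2 : ContDiff ℝ 1 δe_q)
    (h0p : δe_p 0 = 0) (h0q : δe_q 0 = 0)
    (ρ_p : ℝ → Fin l → ℝ) (ρ_q : ℝ → Fin m → ℝ)
    (hρp : Continuous ρ_p) (hρq : Continuous ρ_q)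
    (hbal : ∀ t ∈ Set.Icc (0 : ℝ) t_f,
      δe_p t ⬝ᵥ (Matrix.diagonal d_p).mulVec (deriv δe_p t)
        + δe_q t ⬝ᵥ (Matrix.diagonal d_q).mulVec (deriv δe_q t)
      = -(δe_p t ⬝ᵥ ρ_p t) - δe_q t ⬝ᵥ ρ_q t) :
    (1 / 2) * euclidEnorm ((Matrix.diagonal fun i => Real.sqrt (d_p i)).mulVec (δe_p t_f)) ^ 2
      + (1 / 2) * euclidEnorm ((Matrix.diagonal fun j => Real.sqrt (d_q j)).mulVec (δe_q t_f)) ^ 2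
    ≤ ∫ τ in (0 : ℝ)..t_f,
        (euclidEnorm (ρ_p τ) * euclidEnorm (δe_p τ) + euclidEnorm (ρ_q τ) * euclidEnorm (δe_q τ)) := by
  rw [euclid_energy_eq d_p hdp, euclid_energy_eq d_q hdq]
  have hd := fun t => (euclid_energy_deriv d_p δe_p hc1 t).add (euclid_energy_deriv d_q δe_q hc2 t)
  have hint : ContinuousOn (fun t => -(δe_p t ⬝ᵥ ρ_p t) - δe_q t ⬝ᵥ ρ_q t)
      (Set.uIcc 0 t_f) :=
    ((hc1.continuous.dotProduct hρp).neg.sub (hc2.continuous.dotProduct hρq)).continuousOn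
  have hF := intervalIntegral.integral_eq_sub_of_hasDerivAt
    (f' := fun t => -(δe_p t ⬝ᵥ ρ_p t) - δe_q t ⬝ᵥ ρ_q t) (a := 0) (b := t_f)
    (fun t htt => by
      rw [Set.uIcc_of_le ht.le] at htt
      have := hd t
      rw [hbal t htt] at this
      exact this) hint.intervalIntegrable
  simp only [Pi.add_apply, h0p, h0q, Pi.zero_apply] at hF
  norm_num at hF
  norm_num
  rw [← hF]
  refine intervalIntegral.integral_mono_on ht.le hint.intervalIntegrable ?_ ?_
  · exact (((euclid_continuous hρp).mul (euclid_continuous hc1.continuous)).add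
      ((euclid_continuous hρq).mul (euclid_continuous hc2.continuous))).intervalIntegrable _ _
  · intro t _
    linarith [euclid_abs_dot_le (δe_p t) (ρ_p t), euclid_abs_dot_le (δe_q t) (ρ_q t)]
end

section
/- Let l, m be natural numbers, let d_p : Fin l → ℝ and d_q : Fin m → ℝ have all entries positive, and set M_p = diagonal(d_p), M_q = diagonal(d_q), M_p^{±1/2} = diagonal(d_p^{±1/2}), M_q^{±1/2} = diagonal(d_q^{±1/2}). Let t_f > 0, let δe_p : ℝ → ℝ^l and δe_q : ℝ → ℝ^m be continuously differentiable with δe_p(0) = 0, δe_q(0) = 0, and let ρ_p : ℝ → ℝ^l, ρ_q : ℝ → ℝ^m be continuous such that for all t ∈ [0, t_f]: δe_p(t) · M_p δe_p′(t) + δe_q(t) · M_q δe_q′(t) = −δe_p(t) · ρ_p(t) − δe_q(t) · ρ_q(t). Let t* ∈ [0, t_f] be a point at which t ↦ ‖M_p^{1/2} δe_p(t)‖ + ‖M_q^{1/2} δe_q(t)‖ attains its maximum over [0, t_f]. Then ‖M_p^{1/2} δe_p(t*)‖ + ‖M_q^{1/2} δe_q(t*)‖ ≤ 4 ∫₀^{t_f}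 ( ‖M_p^{−1/2} ρ_p(τ)‖ + ‖M_q^{−1/2} ρ_q(τ)‖ ) dτ. -/
open Matrix

/-- The Euclidean norm of a vector in `ℝ^n`. -/
noncomputable def euclNorm {n : ℕ} (x : Fin n → ℝ) : ℝ := Real.sqrt (x ⬝ᵥ x)

lemma euclNorm_nonneg {n : ℕ} (x : Fin n → ℝ) : 0 ≤ euclNorm x := Real.sqrt_nonneg _

lemma euclNorm_continuous {n : ℕ} (d : Fin n → ℝ) (f : ℝ → Fin n → ℝ) (hf : Continuous f) :
    Continuous fun t => euclNorm ((Matrix.diagonal d).mulVec (f t)) := by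
  unfold euclNorm
  simp only [dotProduct, Matrix.mulVec_diagonal]
  fun_prop

lemma euclNorm_sq {n : ℕ} (d : Fin n → ℝ) (hd : ∀ i, 0 < d i) (x : Fin n → ℝ) :
    euclNorm ((Matrix.diagonal fun i => Real.sqrt (d i)).mulVec x) ^ 2 = ∑ i, d i * x i ^ 2 := by
  unfold euclNorm
  rw [Real.sq_sqrt (by
    simp only [dotProduct]
    exact Finset.sum_nonneg fun i _ => mul_self_nonneg _)]
  simp only [dotProduct, Matrix.mulVec_diagonal]
  refine Finset.sum_congr rfl fun i _ => ?_
  have := Real.sq_sqrt (hd i).le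
  linear_combination (x i) ^ 2 * this

lemma neg_dot_le {n : ℕ} (d : Fin n → ℝ) (hd : ∀ i, 0 < d i) (x r : Fin n → ℝ) :
    -(x ⬝ᵥ r) ≤ euclNorm ((Matrix.diagonal fun i => Real.sqrt (d i)).mulVec x)
      * euclNorm ((Matrix.diagonal fun i => (Real.sqrt (d i))⁻¹).mulVec r) := by
  have h := Real.sum_mul_le_sqrt_mul_sqrt Finset.univ
    (fun i => -(Real.sqrt (d i) * x i)) (fun i => (Real.sqrt (d i))⁻¹ * r i)
  unfold euclNorm
  simp only [dotProduct, Matrix.mulVec_diagonal, ← sq]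
  simp only [neg_sq] at h
  refine le_trans (le_of_eq ?_) h
  rw [← Finset.sum_neg_distrib]
  refine Finset.sum_congr rfl fun i _ => ?_
  have : Real.sqrt (d i) ≠ 0 := (Real.sqrt_pos.2 (hd i)).ne'
  field_simp

lemma energy_deriv {n : ℕ} (d : Fin n → ℝ) (f : ℝ → Fin n → ℝ) (hf : ContDiff ℝ 1 f) (t : ℝ) :
    HasDerivAt (fun t => ∑ i, d i * f t i ^ 2)
      (2 * (f t ⬝ᵥ (Matrix.diagonal d).mulVec (deriv f t))) t := by
  have h : HasDerivAt f (deriv f t) t := (hf.differentiable (by norm_num) t).hasDerivAt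
  have h2 := HasDerivAt.fun_sum (u := Finset.univ) fun i _ =>
    (((hasDerivAt_pi.1 h i).pow 2).const_mul (d i))
  refine h2.congr_deriv ?_
  simp only [dotProduct, Matrix.mulVec_diagonal, Finset.mul_sum]
  refine Finset.sum_congr rfl fun i _ => ?_
  simp
  ring

/-- The main error bound: at a time `t*` maximizing the weighted error norm over
`[0, t_f]`, the weighted error norm is bounded by four times the time integral of the
inversely weighted residue norms. -/
theorem error_bound_weighted (l m : ℕ) (d_p : Fin l → ℝ) (d_q : Fin m → ℝ)
    (hdp : ∀ i, 0 < d_p i) (hdq : ∀ j, 0 < d_q j)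
    (t_f : ℝ) (ht : 0 < t_f)
    (δe_p : ℝ → Fin l → ℝ) (δe_q : ℝ → Fin m → ℝ)
    (hc1 : ContDiff ℝ 1 δe_p) (hc2 : ContDiff ℝ 1 δe_q)
    (h0p : δe_p 0 = 0) (h0q : δe_q 0 = 0)
    (ρ_p : ℝ → Fin l → ℝ) (ρ_q : ℝ → Fin m → ℝ)
    (hρp : Continuous ρ_p) (hρq : Continuous ρ_q)
    (hbal : ∀ t ∈ Set.Icc (0 : ℝ) t_f,
      δe_p t ⬝ᵥ (Matrix.diagonal d_p).mulVec (deriv δe_p t)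
        + δe_q t ⬝ᵥ (Matrix.diagonal d_q).mulVec (deriv δe_q t)
      = -(δe_p t ⬝ᵥ ρ_p t) - δe_q t ⬝ᵥ ρ_q t)
    (tstar : ℝ) (htstar : tstar ∈ Set.Icc (0 : ℝ) t_f)
    (hmax : ∀ t ∈ Set.Icc (0 : ℝ) t_f,
      euclNorm ((Matrix.diagonal fun i => Real.sqrt (d_p i)).mulVec (δe_p t))
          + euclNorm ((Matrix.diagonal fun j => Real.sqrt (d_q j)).mulVec (δe_q t))
        ≤ euclNorm ((Matrix.diagonal fun i => Real.sqrt (d_p i)).mulVec (δe_p tstar))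
          + euclNorm ((Matrix.diagonal fun j => Real.sqrt (d_q j)).mulVec (δe_q tstar))) :
    euclNorm ((Matrix.diagonal fun i => Real.sqrt (d_p i)).mulVec (δe_p tstar))
      + euclNorm ((Matrix.diagonal fun j => Real.sqrt (d_q j)).mulVec (δe_q tstar))
    ≤ 4 * ∫ τ in (0 : ℝ)..t_f,
        (euclNorm ((Matrix.diagonal fun i => (Real.sqrt (d_p i))⁻¹).mulVec (ρ_p τ))
          + euclNorm ((Matrix.diagonal fun j => (Real.sqrt (d_q j))⁻¹).mulVec (ρ_q τ))) := by
  set a : ℝ → ℝ := fun t => euclNorm ((Matrix.diagonal fun i => Real.sqrt (d_p i)).mulVec (δe_p t)) with ha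
  set b : ℝ → ℝ := fun t => euclNorm ((Matrix.diagonal fun i => Real.sqrt (d_q i)).mulVec (δe_q t)) with hb
  set α : ℝ → ℝ := fun t => euclNorm ((Matrix.diagonal fun i => (Real.sqrt (d_p i))⁻¹).mulVec (ρ_p t)) with hα
  set β : ℝ → ℝ := fun t => euclNorm ((Matrix.diagonal fun i => (Real.sqrt (d_q i))⁻¹).mulVec (ρ_q t)) with hβ
  change ∀ t ∈ Set.Icc (0 : ℝ) t_f, a t + b t ≤ a tstar + b tstar at hmax
  change a tstar + b tstar ≤ 4 * ∫ τ in (0 : ℝ)..t_f, (α τ + β τ)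
  have ha0 : ∀ t, 0 ≤ a t := fun t => euclNorm_nonneg _
  have hb0 : ∀ t, 0 ≤ b t := fun t => euclNorm_nonneg _
  have hα0 : ∀ t, 0 ≤ α t := fun t => euclNorm_nonneg _
  have hβ0 : ∀ t, 0 ≤ β t := fun t => euclNorm_nonneg _
  have hαc : Continuous α := euclNorm_continuous _ _ hρp
  have hβc : Continuous β := euclNorm_continuous _ _ hρq
  have hp1 : ∀ t, a t ^ 2 = ∑ i, d_p i * δe_p t i ^ 2 := fun t => euclNorm_sq d_p hdp _
  have hq1 : ∀ t, b t ^ 2 = ∑ i, d_q i * δe_q t i ^ 2 := fun t => euclNorm_sq d_q hdq _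
  have hd : ∀ t, HasDerivAt (fun t => a t ^ 2 + b t ^ 2)
      (2 * (δe_p t ⬝ᵥ (Matrix.diagonal d_p).mulVec (deriv δe_p t))
        + 2 * (δe_q t ⬝ᵥ (Matrix.diagonal d_q).mulVec (deriv δe_q t))) t := by
    intro t
    simp only [hp1, hq1]
    exact (energy_deriv d_p δe_p hc1 t).add (energy_deriv d_q δe_q hc2 t)
  have hcp := hc1.continuous_deriv le_rfl
  have hcq := hc2.continuous_deriv le_rfl
  have hcp0 := hc1.continuous
  have hcq0 := hc2.continuous
  have hD : Continuous fun t => 2 * (δe_p t ⬝ᵥ (Matrix.diagonal d_p).mulVec (deriv δe_p t))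
        + 2 * (δe_q t ⬝ᵥ (Matrix.diagonal d_q).mulVec (deriv δe_q t)) := by
    simp only [dotProduct, Matrix.mulVec_diagonal]
    fun_prop
  have hftc := intervalIntegral.integral_eq_sub_of_hasDerivAt (a := 0) (b := tstar)
    (fun t _ => hd t) (hD.intervalIntegrable _ _)
  have hz : a 0 ^ 2 + b 0 ^ 2 = 0 := by rw [hp1, hq1, h0p, h0q]; simp
  have hc : Continuous fun τ => α τ + β τ := hαc.add hβc
  set S := a tstar + b tstar with hS
  have hle : (∫ t in (0:ℝ)..tstar, (2 * (δe_p t ⬝ᵥ (Matrix.diagonal d_p).mulVec (deriv δe_p t))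
        + 2 * (δe_q t ⬝ᵥ (Matrix.diagonal d_q).mulVec (deriv δe_q t))))
      ≤ ∫ t in (0:ℝ)..tstar, (2 * S) * (α t + β t) := by
    refine intervalIntegral.integral_mono_on htstar.1 (hD.intervalIntegrable _ _)
      ((continuous_const.mul hc).intervalIntegrable _ _) fun t htt => ?_
    have ht' : t ∈ Set.Icc (0 : ℝ) t_f := ⟨htt.1, htt.2.trans htstar.2⟩
    have h1 := hbal t ht'
    have h2 : -(δe_p t ⬝ᵥ ρ_p t) ≤ a t * α t := neg_dot_le d_p hdp _ _
    have h3 : -(δe_q t ⬝ᵥ ρ_q t) ≤ b t * β t := neg_dot_le d_q hdq _ _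
    have h4 := hmax t ht'
    have h5 : a t * α t ≤ S * α t :=
      mul_le_mul_of_nonneg_right (by linarith [hb0 t]) (hα0 t)
    have h6 : b t * β t ≤ S * β t :=
      mul_le_mul_of_nonneg_right (by linarith [ha0 t]) (hβ0 t)
    linarith
  rw [intervalIntegral.integral_const_mul] at hle
  have hI : (∫ t in (0:ℝ)..tstar, (α t + β t)) ≤ ∫ t in (0:ℝ)..t_f, (α t + β t) :=
    intervalIntegral.integral_mono_interval le_rfl htstar.1 htstar.2
      (Filter.Eventually.of_forall fun t => add_nonneg (hα0 t) (hβ0 t))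
      (hc.intervalIntegrable _ _)
  have hI0 : 0 ≤ ∫ t in (0:ℝ)..t_f, (α t + β t) :=
    intervalIntegral.integral_nonneg ht.le fun t _ => add_nonneg (hα0 t) (hβ0 t)
  have hS0 : 0 ≤ S := add_nonneg (ha0 _) (hb0 _)
  have hSI := mul_le_mul_of_nonneg_left hI hS0
  have hsq : S ^ 2 ≤ 2 * (a tstar ^ 2 + b tstar ^ 2) := by
    rw [hS]; nlinarith [sq_nonneg (a tstar - b tstar)]
  have hfin : S * S ≤ S * (4 * ∫ t in (0:ℝ)..t_f, (α t + β t)) := by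
    linarith
  rcases hS0.eq_or_lt with h | h
  · rw [← h]; linarith
  · exact le_of_mul_le_mul_left hfin h
end
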